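/- Let L be a finite-dimensional n-Lie algebra. Then L is nilpotent if and only if [L,L,(n-2)L] ⊆ Φ(L); moreover, if L is nilpotent then Φ(L) = [L,L,(n-2)L]. -/

import Mathlib

namespace NLie

open Finset

variable {F : Type*} [Field F] {L : Type*} [AddCommGroup L] [Module F L] {n : ℕ}

/-- The generalized Jacobi identity for an `(n+2)`-ary alternating bracket:
`[y₁,…,y_{n+1},[x₁,…,x_{n+2}]] = ∑ᵢ [x₁,…,[y₁,…,y_{n+1},xᵢ],…,x_{n+2}]`.
(This is the identity (1) of the paper, rewritten with the string `y` in the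
first `n+1` slots, which is equivalent since the bracket is alternating.) -/
def IsNLie (f : AlternatingMap F L L (Fin (n + 2))) : Prop :=
  ∀ (y : Fin (n + 1) → L) (x : Fin (n + 2) → L),
    f (Fin.snoc y (f x)) = ∑ i, f (Function.update x i (f (Fin.snoc y (x i))))

/-- `d : L → L` is a derivation of the bracket `f`. -/
def IsDerivation (f : AlternatingMap F L L (Fin (n + 2))) (d : L →ₗ[F] L) : Prop :=
  ∀ x : Fin (n + 2) → L, d (f x) = ∑ i, f (Function.update x i (d (x i)))

/-- The (inner) derivation `D(a₁,…,a_{n+1}) : x ↦ [a₁,…,a_{n+1},x]`. -/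
def D (f : AlternatingMap F L L (Fin (n + 2))) (a : Fin (n + 1) → L) : L →ₗ[F] L where
  toFun x := f (Fin.snoc a x)
  map_add' x y := by
    have h := f.toMultilinearMap.map_update_add (Fin.snoc a x) (Fin.last (n + 1)) x y
    simpa [Fin.update_snoc_last] using h
  map_smul' c x := by
    have h := f.toMultilinearMap.map_update_smul (Fin.snoc a x) (Fin.last (n + 1)) c x
    simpa [Fin.update_snoc_last] using h

/-- `D(U)`: the span of all inner derivations `D(a₁,…,a_{n+1})` with all `aᵢ ∈ U`. -/
def Dspan (f : AlternatingMap F L L (Fin (n + 2))) (U : Submodule F L) :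
    Submodule F (L →ₗ[F] L) :=
  Submodule.span F {d | ∃ a : Fin (n + 1) → L, (∀ i, a i ∈ U) ∧ d = D f a}

/-- The Engel subspace `E_L(d) = {x ∈ L ∣ dʳ x = 0 for some r}`. -/
def engel (d : L →ₗ[F] L) : Submodule F L where
  carrier := {x | ∃ r, (d ^ r) x = 0}
  zero_mem' := ⟨0, map_zero _⟩
  add_mem' := by
    rintro a b ⟨r, hr⟩ ⟨s, hs⟩
    refine ⟨r + s, ?_⟩
    have h1 : (d ^ (r + s)) a = (d ^ s) ((d ^ r) a) := by
      rw [add_comm r s, pow_add]; rfl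
    have h2 : (d ^ (r + s)) b = (d ^ r) ((d ^ s) b) := by
      rw [pow_add]; rfl
    rw [map_add, h1, h2, hr, hs, map_zero, map_zero, add_zero]
  smul_mem' := by
    rintro c a ⟨r, hr⟩
    exact ⟨r, by rw [map_smul, hr, smul_zero]⟩

/-- `E` is an Engel subalgebra of `L`: `E = E_L(d)` for some inner derivation `d ∈ D(E)`. -/
def IsEngel (f : AlternatingMap F L L (Fin (n + 2))) (E : Submodule F L) : Prop :=
  ∃ d : L →ₗ[F] L, d ∈ Dspan f E ∧ E = engel d

/-- `[A₁,…,A_{n+2}]`: the subspace spanned by all brackets with `aᵢ ∈ Aᵢ`. -/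
def bracketSpan (f : AlternatingMap F L L (Fin (n + 2))) (A : Fin (n + 2) → Submodule F L) :
    Submodule F L :=
  Submodule.span F {z | ∃ a : Fin (n + 2) → L, (∀ i, a i ∈ A i) ∧ f a = z}

/-- `K` is a subalgebra of `L`. -/
def IsSubalg (f : AlternatingMap F L L (Fin (n + 2))) (K : Submodule F L) : Prop :=
  ∀ a : Fin (n + 2) → L, (∀ i, a i ∈ K) → f a ∈ K

/-- `K` is an ideal of `L` : `[K,L,…,L] ⊆ K`. -/
def IsIdeal (f : AlternatingMap F L L (Fin (n + 2))) (K : Submodule F L) : Prop :=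
  ∀ a : Fin (n + 2) → L, a 0 ∈ K → f a ∈ K

/-- `V` is an ideal of the subalgebra `W`. -/
def IsIdealIn (f : AlternatingMap F L L (Fin (n + 2))) (V W : Submodule F L) : Prop :=
  V ≤ W ∧ ∀ a : Fin (n + 2) → L, a 0 ∈ V → (∀ i, a i ∈ W) → f a ∈ V

/-- `M` is a maximal proper subalgebra of `L`. -/
def IsMaximalSubalg (f : AlternatingMap F L L (Fin (n + 2))) (M : Submodule F L) : Prop :=
  IsSubalg f M ∧ M ≠ ⊤ ∧ ∀ U : Submodule F L, IsSubalg f U → M < U → U = ⊤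

/-- The Frattini subalgebra: the intersection of all maximal proper subalgebras. -/
def frattini (f : AlternatingMap F L L (Fin (n + 2))) : Submodule F L :=
  sInf {M | IsMaximalSubalg f M}

/-- The lower central series of a subalgebra `U`:
`U¹ = U`, `U^{s+1} = [Uˢ, U,…,U]`. (`lcsIn f U s` is `U^{s+1}`.) -/
def lcsIn (f : AlternatingMap F L L (Fin (n + 2))) (U : Submodule F L) : ℕ → Submodule F L
  | 0 => U
  | s + 1 => bracketSpan f (Fin.cons (lcsIn f U s) fun _ => U)

/-- `L` is a nilpotent `(n+2)`-Lie algebra. -/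
def IsNilpotentAlg (f : AlternatingMap F L L (Fin (n + 2))) : Prop :=
  ∃ r, lcsIn f ⊤ r = ⊥

/-- The lower central series of `U` modulo `K`: `U/K` is nilpotent iff some term
of this series is contained in `K`. -/
def lcsMod (f : AlternatingMap F L L (Fin (n + 2))) (U K : Submodule F L) : ℕ → Submodule F L
  | 0 => U
  | s + 1 => bracketSpan f (Fin.cons (lcsMod f U K s) fun _ => U) ⊔ K

/-- The series `K¹ = K`, `K^{s+1} = [Kˢ, K, L,…,L]` used to define
"2-nilpotently embedded". -/
def nes2 (f : AlternatingMap F L L (Fin (n + 2))) (K : Submodule F L) : ℕ → Submodule F L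
  | 0 => K
  | s + 1 => bracketSpan f (Fin.cons (nes2 f K s) (Fin.cons K fun _ => ⊤))

/-- The series of `B` modulo `A`, so that `B/A` is 2-nilpotently embedded in `L/A`
iff some term of this series is contained in `A`. -/
def nes2Mod (f : AlternatingMap F L L (Fin (n + 2))) (B A : Submodule F L) : ℕ → Submodule F L
  | 0 => B
  | s + 1 => bracketSpan f (Fin.cons (nes2Mod f B A s) (Fin.cons B fun _ => ⊤)) ⊔ A

/-- The 2-derived series: `L⁽⁰⁾ = L`, `L⁽ˢ⁺¹⁾ = [L⁽ˢ⁾, L⁽ˢ⁾, L,…,L]`. -/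
def ds2 (f : AlternatingMap F L L (Fin (n + 2))) : ℕ → Submodule F L
  | 0 => ⊤
  | s + 1 => bracketSpan f (Fin.cons (ds2 f s) (Fin.cons (ds2 f s) fun _ => ⊤))

/-- `L` is 2-soluble. -/
def Is2Soluble (f : AlternatingMap F L L (Fin (n + 2))) : Prop :=
  ∃ r, ds2 f r = ⊥

/-- The `k`-derived series of an ideal `K`:
`K⁽⁰⁾ = K`, `K⁽ˢ⁺¹⁾ = [(k)K⁽ˢ⁾, (n+2-k)L]`: `K` is `k`-solubly embedded in `L`
iff some term vanishes. -/
def dsk (f : AlternatingMap F L L (Fin (n + 2))) (k : ℕ) (K : Submodule F L) :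
    ℕ → Submodule F L
  | 0 => K
  | s + 1 => bracketSpan f (fun i => if (i : ℕ) < k then dsk f k K s else ⊤)

/-- The `k`-derived series of `A` modulo `B`: `A/B` is `k`-solubly embedded in `L/B`
iff some term of this series is contained in `B`. -/
def dskMod (f : AlternatingMap F L L (Fin (n + 2))) (k : ℕ) (A B : Submodule F L) :
    ℕ → Submodule F L
  | 0 => A
  | s + 1 => bracketSpan f (fun i => if (i : ℕ) < k then dskMod f k A B s else ⊤) ⊔ B

/-- The ideal `A` is abelian embedded in `L`: `[A,A,L,…,L] = 0`. -/
def IsAbelianEmbedded (f : AlternatingMap F L L (Fin (n + 2))) (A : Submodule F L) : Prop :=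
  ∀ a : Fin (n + 2) → L, a 0 ∈ A → a 1 ∈ A → f a = 0

/-- `A` is a minimal abelian embedded ideal of `L`: a nonzero abelian embedded ideal
whose only properly contained ideal is `0`. -/
def IsMinAbelianEmbeddedIdeal (f : AlternatingMap F L L (Fin (n + 2)))
    (A : Submodule F L) : Prop :=
  A ≠ ⊥ ∧ IsIdeal f A ∧ IsAbelianEmbedded f A ∧
    ∀ B : Submodule F L, IsIdeal f B → B < A → B = ⊥

/-- The normalizer `N_L(U) = {x ∈ L ∣ [x,u₁,…,u_{n+1}] ∈ U for all uᵢ ∈ U}`. -/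
def normalizer (f : AlternatingMap F L L (Fin (n + 2))) (U : Submodule F L) : Set L :=
  {x | ∀ u : Fin (n + 1) → L, (∀ i, u i ∈ U) → f (Fin.cons x u) ∈ U}

/-- The centralizer `C_L(A) = {c ∈ L ∣ [c,a,x₃,…,x_{n+2}] = 0 for all a ∈ A, xᵢ ∈ L}`. -/
def centralizer (f : AlternatingMap F L L (Fin (n + 2))) (A : Submodule F L) : Set L :=
  {c | ∀ a ∈ A, ∀ x : Fin n → L, f (Fin.cons c (Fin.cons a x)) = 0}

/-- `S` is a Cartan subalgebra of `L`: a nilpotent self-normalizing subalgebra. -/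
def IsCartan (f : AlternatingMap F L L (Fin (n + 2))) (S : Submodule F L) : Prop :=
  IsSubalg f S ∧ (∃ r, lcsIn f S r = ⊥) ∧ normalizer f S = (S : Set L)

/-- `U` is a subnormal subalgebra of `L`. -/
def IsSubnormal (f : AlternatingMap F L L (Fin (n + 2))) (U : Submodule F L) : Prop :=
  ∃ (r : ℕ) (C : ℕ → Submodule F L), C 0 = U ∧ C r = ⊤ ∧
    (∀ i ≤ r, IsSubalg f (C i)) ∧ ∀ i < r, IsIdealIn f (C i) (C (i + 1))

/-- An `A`-inner automorphism: a finite product of maps `1 + D(a,x₂,…,x_{n+1})`,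
`a ∈ A`, where `A` is an abelian embedded ideal. -/
def IsAInner (f : AlternatingMap F L L (Fin (n + 2))) (A : Submodule F L)
    (α : L →ₗ[F] L) : Prop :=
  ∃ (m : ℕ) (g : Fin m → (L →ₗ[F] L)),
    (∀ j, ∃ (a : L) (x : Fin n → L), a ∈ A ∧ g j = LinearMap.id + D f (Fin.cons a x)) ∧
    α = (List.ofFn g).prod


lemma apply_mem_bracketSpan (f : AlternatingMap F L L (Fin (n + 2))) {A : Fin (n + 2) → Submodule F L}
    {a : Fin (n + 2) → L} (ha : ∀ i, a i ∈ A i) : f a ∈ bracketSpan f A :=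
  Submodule.subset_span ⟨a, ha, rfl⟩

lemma bracketSpan_le (f : AlternatingMap F L L (Fin (n + 2))) {A : Fin (n + 2) → Submodule F L}
    {K : Submodule F L} : bracketSpan f A ≤ K ↔ ∀ a, (∀ i, a i ∈ A i) → f a ∈ K := by
  refine Submodule.span_le.trans ⟨fun h a ha => h ⟨a, ha, rfl⟩, ?_⟩
  rintro h _ ⟨a, ha, rfl⟩
  exact h a ha

lemma apply_mem_lcsIn_succ (f : AlternatingMap F L L (Fin (n + 2))) {s : ℕ}
    {a : Fin (n + 2) → L} (i : Fin (n + 2)) (hi : a i ∈ lcsIn f ⊤ s) :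
    f a ∈ lcsIn f ⊤ (s + 1) := by
  have key : f (a ∘ Equiv.swap 0 i) ∈ lcsIn f ⊤ (s + 1) := by
    refine apply_mem_bracketSpan f fun j => ?_
    refine Fin.cases ?_ (fun k => ?_) j
    · simpa using hi
    · simp
  rw [f.map_perm] at key
  rcases Int.units_eq_one_or (Equiv.Perm.sign (Equiv.swap 0 i)) with h | h
  · simpa [h] using key
  · simpa [h] using key

lemma isSubalg_of_bracketSpan_le (f : AlternatingMap F L L (Fin (n + 2))) {K : Submodule F L}
    (h : bracketSpan f (fun _ => (⊤ : Submodule F L)) ≤ K) : IsSubalg f K :=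
  fun _ _ => h (apply_mem_bracketSpan f fun _ => Submodule.mem_top)

lemma frattini_le_bracketSpan (f : AlternatingMap F L L (Fin (n + 2))) :
    frattini f ≤ bracketSpan f (fun _ => (⊤ : Submodule F L)) := by
  intro v hv
  by_contra hv'
  obtain ⟨φ, hφv, hφ⟩ := Submodule.exists_le_ker_of_notMem hv'
  have hφ0 : φ ≠ 0 := fun h => hφv (by simp [h])
  have hcoatom := LinearMap.isCoatom_ker_of_surjective (LinearMap.surjective hφ0)
  have hmax : IsMaximalSubalg f (LinearMap.ker φ) :=
    ⟨isSubalg_of_bracketSpan_le f hφ, hcoatom.1, fun U _ hU => hcoatom.2 U hU⟩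
  exact hφv (Submodule.mem_sInf.1 hv _ hmax)

/-- Changing arguments by elements of a term of the lower central series changes the bracket
by an element of the next term. -/
lemma apply_add_mem (f : AlternatingMap F L L (Fin (n + 2))) {M : Submodule F L}
    (hM : IsSubalg f M) {s : ℕ} (hs : lcsIn f ⊤ (s + 1) ≤ M) {m l : Fin (n + 2) → L}
    (hm : ∀ i, m i ∈ M) (hl : ∀ i, l i ∈ lcsIn f ⊤ s) : f (m + l) ∈ M := by
  have h := f.toMultilinearMap.map_add_univ m l
  change f (m + l) = _ at h
  rw [h]
  refine Submodule.sum_mem _ fun S _ => ?_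
  by_cases hS : S = univ
  · subst hS
    simpa using hM m hm
  · obtain ⟨i, hi⟩ : ∃ i, i ∉ S := by simpa [Finset.eq_univ_iff_forall] using hS
    exact hs (apply_mem_lcsIn_succ f i (by simpa [hi] using hl i))

lemma bracketSpan_le_of_isMaximalSubalg (f : AlternatingMap F L L (Fin (n + 2)))
    (hL : IsNilpotentAlg f) {M : Submodule F L} (hM : IsMaximalSubalg f M) :
    bracketSpan f (fun _ => (⊤ : Submodule F L)) ≤ M := by
  obtain ⟨hsub, hne, hmax⟩ := hM
  obtain ⟨r, hr⟩ := hL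
  obtain ⟨s, hs, hs'⟩ : ∃ s, ¬ lcsIn f ⊤ s ≤ M ∧ lcsIn f ⊤ (s + 1) ≤ M := by
    by_contra! h
    have : ∀ s, ¬ lcsIn f ⊤ s ≤ M := fun s => by
      induction s with
      | zero => simpa [lcsIn] using hne
      | succ s ih => exact h s ih
    exact this r (hr ▸ bot_le)
  have hmem : ∀ a : Fin (n + 2) → L, (∀ i, a i ∈ M ⊔ lcsIn f ⊤ s) → f a ∈ M := by
    intro a ha
    choose m hm l hl hml using fun i => Submodule.mem_sup.1 (ha i)
    rw [← show m + l = a from funext hml]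
    exact apply_add_mem f hsub hs' hm hl
  have htop : M ⊔ lcsIn f ⊤ s = ⊤ :=
    hmax _ (fun a ha => Submodule.mem_sup_left (hmem a ha)) (left_lt_sup.2 hs)
  rw [htop] at hmem
  exact (bracketSpan_le f).2 hmem

lemma isDerivation_of_mem_Dspan {f : AlternatingMap F L L (Fin (n + 2))} (hf : IsNLie f)
    {U : Submodule F L} {d : L →ₗ[F] L} (hd : d ∈ Dspan f U) : IsDerivation f d := by
  induction hd using Submodule.span_induction with
  | mem d hd =>
    obtain ⟨a, -, rfl⟩ := hd
    exact hf a
  | zero => intro x; simp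
  | add d e _ _ hd he => intro x; simp [hd x, he x, Finset.sum_add_distrib]
  | smul c d _ hd => intro x; simp [hd x, Finset.smul_sum]

lemma apply_mem_engel {f : AlternatingMap F L L (Fin (n + 2))} {d : L →ₗ[F] L}
    (hd : IsDerivation f d) (N : ℕ) (x : Fin (n + 2) → L) (r : Fin (n + 2) → ℕ)
    (hr : ∑ i, r i ≤ N) (hx : ∀ i, (d ^ r i) (x i) = 0) : f x ∈ engel d := by
  induction N generalizing x r with
  | zero =>
    have h0 : r 0 = 0 := by
      have := Finset.single_le_sum (f := r) (fun i _ => Nat.zero_le _) (Finset.mem_univ 0)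
      omega
    have : x 0 = 0 := by simpa [h0] using hx 0
    rw [f.map_coord_zero 0 this]
    exact zero_mem _
  | succ N ih =>
    have hdx : d (f x) ∈ engel d := by
      rw [hd x]
      refine Submodule.sum_mem _ fun i _ => ?_
      rcases Nat.eq_zero_or_pos (r i) with h0 | hpos
      · have : x i = 0 := by simpa [h0] using hx i
        rw [f.map_coord_zero i (by simp [this])]
        exact zero_mem _
      · refine ih _ (Function.update r i (r i - 1)) ?_ fun j => ?_
        · have h1 := Finset.sum_update_of_mem (Finset.mem_univ i) r (r i - 1)
          have h2 := Finset.add_sum_erase univ r (Finset.mem_univ i)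
          rw [Finset.sdiff_singleton_eq_erase] at h1
          omega
        · rcases eq_or_ne j i with rfl | hj
          · have := hx j
            rw [← Nat.sub_add_cancel hpos, pow_succ] at this
            simpa using this
          · simpa [hj] using hx j
    obtain ⟨k, hk⟩ := hdx
    exact ⟨k + 1, by rw [pow_succ]; exact hk⟩

lemma isSubalg_engel {f : AlternatingMap F L L (Fin (n + 2))} {d : L →ₗ[F] L}
    (hd : IsDerivation f d) : IsSubalg f (engel d) := by
  intro a ha
  choose r hr using ha
  exact apply_mem_engel hd _ a r le_rfl hr

lemma exists_isMaximalSubalg_ge [FiniteDimensional F L] (f : AlternatingMap F L L (Fin (n + 2)))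
    {E : Submodule F L} (hE : IsSubalg f E) (hne : E ≠ ⊤) :
    ∃ M, IsMaximalSubalg f M ∧ E ≤ M := by
  obtain ⟨M, ⟨hM, hMne, hEM⟩, hmax⟩ := (wellFounded_gt (α := Submodule F L)).has_min
    {K | IsSubalg f K ∧ K ≠ ⊤ ∧ E ≤ K} ⟨E, hE, hne, le_rfl⟩
  refine ⟨M, ⟨hM, hMne, fun U hU hlt => ?_⟩, hEM⟩
  by_contra hU'
  exact hmax U ⟨hU, hU', hEM.trans hlt.le⟩ hlt

lemma range_le_bracketSpan_of_mem_Dspan {f : AlternatingMap F L L (Fin (n + 2))}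
    {U : Submodule F L} {d : L →ₗ[F] L} (hd : d ∈ Dspan f U) (x : L) :
    d x ∈ bracketSpan f (fun _ => (⊤ : Submodule F L)) := by
  induction hd using Submodule.span_induction with
  | mem d hd =>
    obtain ⟨a, -, rfl⟩ := hd
    exact apply_mem_bracketSpan f fun _ => Submodule.mem_top
  | zero => simp
  | add d e _ _ hd he => exact add_mem hd he
  | smul c d _ hd => exact Submodule.smul_mem _ c hd

lemma isNilpotent_of_mem_Dspan [FiniteDimensional F L] {f : AlternatingMap F L L (Fin (n + 2))}
    (hf : IsNLie f) (h : bracketSpan f (fun _ => (⊤ : Submodule F L)) ≤ frattini f)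
    {U : Submodule F L} {d : Module.End F L} (hd : d ∈ Dspan f U) : IsNilpotent d := by
  obtain ⟨k, hk⟩ := Filter.eventually_atTop.1 d.eventually_isCompl_ker_pow_range_pow
  have hcompl := hk (k + 1) (Nat.le_succ k)
  have hker : LinearMap.ker (d ^ (k + 1)) ≤ engel d := fun x hx => ⟨k + 1, hx⟩
  have hrange : LinearMap.range (d ^ (k + 1)) ≤
      bracketSpan f (fun _ => (⊤ : Submodule F L)) := by
    rintro _ ⟨x, rfl⟩
    rw [pow_succ']
    exact range_le_bracketSpan_of_mem_Dspan hd _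
  have htop : engel d = ⊤ := by
    by_contra hne
    obtain ⟨M, hM, hEM⟩ :=
      exists_isMaximalSubalg_ge f (isSubalg_engel (isDerivation_of_mem_Dspan hf hd)) hne
    refine hM.2.1 (top_le_iff.1 ?_)
    rw [← hcompl.sup_eq_top]
    exact sup_le (hker.trans hEM) (hrange.trans (h.trans (sInf_le hM)))
  refine Module.End.isNilpotent_iff_of_finite.2 fun x => ?_
  have hx : x ∈ engel d := htop ▸ Submodule.mem_top
  exact hx

lemma lie_D {f : AlternatingMap F L L (Fin (n + 2))} {d : Module.End F L}
    (hd : IsDerivation f d) (b : Fin (n + 1) → L) :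
    (⁅d, (D f b : Module.End F L)⁆ : Module.End F L) =
      ∑ i, D f (Function.update b i (d (b i))) := by
  ext x
  have h := hd (Fin.snoc b x)
  rw [Fin.sum_univ_castSucc] at h
  simp only [Fin.snoc_castSucc, Fin.snoc_last, Fin.update_snoc_last, ← Fin.snoc_update] at h
  rw [LinearMap.sum_apply]
  change d (f (Fin.snoc b x)) - f (Fin.snoc b (d x)) = ∑ i, f _
  rw [h, add_sub_cancel_right]

attribute [local instance] LieRing.ofAssociativeRing

/-- The Lie algebra of inner derivations of an `(n+2)`-Lie algebra. -/
def innerDerivations (f : AlternatingMap F L L (Fin (n + 2))) (hf : IsNLie f) :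
    LieSubalgebra F (Module.End F L) where
  __ := (Dspan f ⊤ : Submodule F (Module.End F L))
  lie_mem' := by
    intro d e hd he
    change e ∈ Dspan f ⊤ at he
    change _ ∈ Dspan f ⊤
    induction he using Submodule.span_induction with
    | mem e he =>
      obtain ⟨b, -, rfl⟩ := he
      rw [lie_D (isDerivation_of_mem_Dspan hf hd)]
      exact Submodule.sum_mem _ fun i _ => Submodule.subset_span ⟨_, fun _ => trivial, rfl⟩
    | zero => rw [lie_zero]; exact zero_mem _
    | add a b _ _ ha hb => rw [lie_add]; exact add_mem ha hb
    | smul c a _ ha => rw [lie_smul]; exact Submodule.smul_mem _ c ha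

lemma lcsIn_le_lowerCentralSeries (f : AlternatingMap F L L (Fin (n + 2))) (hf : IsNLie f)
    (s : ℕ) : lcsIn f ⊤ s ≤
      (LieModule.lowerCentralSeries F (innerDerivations f hf) L s).toSubmodule := by
  induction s with
  | zero => simp
  | succ s ih =>
    refine (bracketSpan_le f).2 fun a ha => ?_
    have h0 : a 0 ∈ LieModule.lowerCentralSeries F (innerDerivations f hf) L s := ih (ha 0)
    let d : innerDerivations f hf :=
      ⟨D f (Fin.tail a), Submodule.subset_span ⟨_, fun _ => trivial, rfl⟩⟩
    have key : ⁅d, a 0⁆ ∈ LieModule.lowerCentralSeries F (innerDerivations f hf) L (s + 1) := by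
      rw [LieModule.lowerCentralSeries_succ]
      exact LieSubmodule.lie_mem_lie (LieSubmodule.mem_top d) h0
    change f (Fin.snoc (Fin.tail a) (a 0)) ∈ _ at key
    rw [Fin.snoc_eq_cons_rotate, Fin.cons_self_tail] at key
    have hperm := f.map_perm a (finRotate (n + 2))
    change f (fun i => a (finRotate (n + 2) i)) = _ at hperm
    rw [hperm] at key
    rw [LieSubmodule.mem_toSubmodule]
    rcases Int.units_eq_one_or (Equiv.Perm.sign (finRotate (n + 2))) with h | h
    · simpa only [h, one_smul] using key
    · simpa only [h, Units.neg_smul, one_smul, neg_mem_iff] using key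

lemma isNilpotentAlg_of_bracketSpan_le_frattini [FiniteDimensional F L]
    {f : AlternatingMap F L L (Fin (n + 2))} (hf : IsNLie f)
    (h : bracketSpan f (fun _ => (⊤ : Submodule F L)) ≤ frattini f) : IsNilpotentAlg f := by
  have hnil : LieModule.IsNilpotent (innerDerivations f hf) L :=
    (LieModule.isNilpotent_iff_forall' (R := F)).2 fun d => isNilpotent_of_mem_Dspan hf h d.2
  obtain ⟨k, hk⟩ := (LieModule.isNilpotent_iff F (innerDerivations f hf) L).1 hnil
  refine ⟨k, eq_bot_iff.2 ?_⟩
  have := lcsIn_le_lowerCentralSeries f hf k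
  rwa [hk] at this

/-- `L` is nilpotent iff `[L,L,(n-2)L] ⊆ Φ(L)`; moreover if `L` is
nilpotent then `Φ(L) = [L,L,(n-2)L]`. -/
theorem stmt3 {F : Type*} [Field F] {L : Type*} [AddCommGroup L] [Module F L]
    [FiniteDimensional F L] {n : ℕ} (f : AlternatingMap F L L (Fin (n + 2)))
    (hf : IsNLie f) :
    (IsNilpotentAlg f ↔ bracketSpan f (fun _ => (⊤ : Submodule F L)) ≤ frattini f) ∧
    (IsNilpotentAlg f → frattini f = bracketSpan f (fun _ => (⊤ : Submodule F L))) := by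
  have hle (hL : IsNilpotentAlg f) :
      bracketSpan f (fun _ => (⊤ : Submodule F L)) ≤ frattini f :=
    le_sInf fun _ hM => bracketSpan_le_of_isMaximalSubalg f hL hM
  exact ⟨⟨hle, isNilpotentAlg_of_bracketSpan_le_frattini hf⟩,
    fun hL => (frattini_le_bracketSpan f).antisymm (hle hL)⟩

end NLie
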